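/- arXiv:2509.01266 — 4 statements merged into one kernel-verified Lean document; each statement's English description precedes it below -/
import Mathlib

section
/- Let d ≥ 1, λ > 3d/2 and λ' > λ + 1. There exists a constant C > 0, depending only on d, λ, λ', such that for every μ ∈ H^{λ'}(𝕋^d), every vector-valued kernel K ∈ L^1(𝕋^d; ℝ^d) and every f ∈ H^{-λ-1}(𝕋^d), the distribution ∇·(μ (K*f)) (divergence of the product of the function μ with the componentwise convolution K*f) belongs to H^{-λ-2}(𝕋^d) and ‖∇·(μ (K*f))‖_{H^{-λ-2}(𝕋^d)} ≤ C ‖μ‖_{H^{λ'}(𝕋^d)} ‖f‖_{H^{-λ-1}(𝕋^d)} ‖K‖_{L^1(𝕋^d)}. -/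
open MeasureTheory Complex Filter
open scoped BigOperators

noncomputable section
namespace PaperTorus

/-- The lattice `ℤ^d` of Fourier modes of the torus `𝕋^d = (ℝ/ℤ)^d`. -/
abbrev Lat (d : ℕ) := Fin d → ℤ

/-- A distribution `f` on the torus `𝕋^d`, encoded by the family of its pairings
`⟨f, e_k⟩ = f(e_k)` with the characters `e_k(x) = exp(2πi k·x)`, `k ∈ ℤ^d`. -/
abbrev Coef (d : ℕ) := Lat d → ℂ

/-- The Japanese bracket `⟨k⟩ = (1 + |k|²)^(1/2)`. -/
def jap {d : ℕ} (k : Lat d) : ℝ := Real.sqrt (1 + ∑ i, ((k i : ℝ)) ^ 2)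

/-- Membership `f ∈ Hˢ(𝕋^d)`: the series `Σ_k ⟨k⟩^(2s) |⟨f,e_k⟩|²` converges. -/
def MemSob {d : ℕ} (s : ℝ) (f : Coef d) : Prop :=
  Summable fun k : Lat d => jap k ^ (2 * s) * ‖f k‖ ^ 2

/-- The Sobolev norm `‖f‖_{Hˢ(𝕋^d)} = (Σ_k ⟨k⟩^(2s) |⟨f,e_k⟩|²)^(1/2)`. -/
def sobNorm {d : ℕ} (s : ℝ) (f : Coef d) : ℝ :=
  Real.sqrt (∑' k : Lat d, jap k ^ (2 * s) * ‖f k‖ ^ 2)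

/-- The inner product `⟨f,g⟩_{Hˢ(𝕋^d)} = Σ_k ⟨k⟩^(2s) ⟨f,e_k⟩ conj(⟨g,e_k⟩)`. -/
def sobInner {d : ℕ} (s : ℝ) (f g : Coef d) : ℂ :=
  ∑' k : Lat d, ((jap k ^ (2 * s) : ℝ) : ℂ) * f k * (starRingEnd ℂ) (g k)

/-- The fundamental domain `[0,1)^d` of the torus `𝕋^d`. -/
def box (d : ℕ) : Set (Fin d → ℝ) := Set.univ.pi fun _ => Set.Ico (0 : ℝ) 1

/-- `ℤ^d`-periodicity: `g` is (the lift of) a function on the torus `𝕋^d`. -/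
def TorusFun {d : ℕ} {α : Type*} (g : (Fin d → ℝ) → α) : Prop :=
  ∀ (x : Fin d → ℝ) (m : Lat d), g (fun i => x i + (m i : ℝ)) = g x

/-- The character `e_k(x) = exp(2πi k·x)` on the torus. -/
def eChar {d : ℕ} (k : Lat d) (x : Fin d → ℝ) : ℂ :=
  Complex.exp (2 * (Real.pi : ℂ) * Complex.I * ∑ i, (k i : ℂ) * (x i : ℂ))

/-- The pairing `⟨g, e_k⟩ = ∫_{𝕋^d} g e_k` of an integrable function `g` on the
torus with the character `e_k`; for `g ∈ L¹(𝕋^d)` this encodes `g` as a distribution. -/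
def fCoef {d : ℕ} (g : (Fin d → ℝ) → ℂ) (k : Lat d) : ℂ :=
  ∫ x in box d, g x * eChar k x

/-- Pairings of the distributional partial derivative:
`⟨∂_{x_j} f, e_k⟩ = -⟨f, ∂_{x_j} e_k⟩ = -2πi k_j ⟨f, e_k⟩`. -/
def pderivCoef {d : ℕ} (j : Fin d) (f : Coef d) : Coef d :=
  fun k => -(2 * (Real.pi : ℂ) * Complex.I * (k j : ℂ)) * f k

/-- Pairings of the product `a·b` of a function `a` with a distribution `b` (both
encoded by their pairings with the characters): `⟨a·b, e_k⟩ = Σ_l ⟨a,e_l⟩⟨b,e_{k-l}⟩`. -/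
def prodCoef {d : ℕ} (a b : Coef d) : Coef d :=
  fun k => ∑' l : Lat d, a l * b (k - l)

/-- Pairings of the divergence `∇·v` of a vector of distributions. -/
def divCoef {d : ℕ} (v : Fin d → Coef d) : Coef d :=
  fun k => ∑ j, pderivCoef j (v j) k

theorem jap_sq {d : ℕ} (k : Lat d) : jap k ^ 2 = 1 + ∑ i, ((k i : ℝ)) ^ 2 :=
  Real.sq_sqrt (by positivity)

theorem one_le_jap {d : ℕ} (k : Lat d) : 1 ≤ jap k := by
  unfold jap
  rw [Real.one_le_sqrt]
  have : 0 ≤ ∑ i, ((k i : ℝ)) ^ 2 := by positivity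
  linarith

theorem jap_pos {d : ℕ} (k : Lat d) : 0 < jap k := lt_of_lt_of_le one_pos (one_le_jap k)

theorem abs_le_jap {d : ℕ} (k : Lat d) (j : Fin d) : |(k j : ℝ)| ≤ jap k := by
  apply abs_le_of_sq_le_sq _ (jap_pos k).le
  rw [jap_sq]
  have := Finset.single_le_sum (f := fun i => ((k i : ℝ)) ^ 2) (fun i _ => sq_nonneg _)
    (Finset.mem_univ j)
  linarith

theorem jap_sub_le {d : ℕ} (k l : Lat d) : jap (k - l) ≤ 2 * max (jap k) (jap l) := by
  have hm1 : jap k ≤ max (jap k) (jap l) := le_max_left _ _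
  have hm2 : jap l ≤ max (jap k) (jap l) := le_max_right _ _
  have hk := jap_pos k
  have hl := jap_pos l
  set m := max (jap k) (jap l)
  apply le_of_sq_le_sq _ (by linarith)
  have h1 : jap k ^ 2 ≤ m ^ 2 := by gcongr
  have h2 : jap l ^ 2 ≤ m ^ 2 := by gcongr
  have h3 : ∑ i, (((k - l) i : ℤ) : ℝ) ^ 2 ≤ 2 * ∑ i, ((k i : ℝ)) ^ 2 + 2 * ∑ i, ((l i : ℝ)) ^ 2 := by
    rw [Finset.mul_sum, Finset.mul_sum, ← Finset.sum_add_distrib]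
    apply Finset.sum_le_sum
    intro i _
    simp only [Pi.sub_apply, Int.cast_sub]
    nlinarith [sq_nonneg ((k i : ℝ) + l i)]
  rw [jap_sq] at h1 h2 ⊢
  nlinarith

theorem jap_sub_rpow_le {d : ℕ} (k l : Lat d) {s : ℝ} (hs : 0 ≤ s) :
    jap (k - l) ^ s ≤ 2 ^ s * (jap k ^ s + jap l ^ s) := by
  have hk := jap_pos k
  have hl := jap_pos l
  have h0 := jap_pos (k - l)
  have h1 : 0 ≤ jap k ^ s := by positivity
  have h2 : 0 ≤ jap l ^ s := by positivity
  calc jap (k - l) ^ s ≤ (2 * max (jap k) (jap l)) ^ s :=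
        Real.rpow_le_rpow h0.le (jap_sub_le k l) hs
    _ = 2 ^ s * (max (jap k) (jap l)) ^ s :=
        Real.mul_rpow (by norm_num) (le_max_of_le_left hk.le)
    _ ≤ _ := by
        gcongr
        rcases max_choice (jap k) (jap l) with h | h <;> rw [h] <;> linarith

theorem summable_jap (d : ℕ) {r : ℝ} (hr : r < -(d : ℝ)) :
    Summable fun k : Lat d => jap k ^ r := by
  let L : Submodule ℤ (Fin d → ℝ) := Submodule.span ℤ (Set.range (Pi.basisFun ℝ (Fin d)))
  have hrank : Module.finrank ℤ L = d := by
    have := ZLattice.rank ℝ L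
    simpa using this
  have hS := ZLattice.summable_norm_rpow L r (by rw [hrank]; exact hr)
  have hmem : ∀ k : Lat d, (fun i => (k i : ℝ)) ∈ L := by
    intro k
    rw [Module.Basis.mem_span_iff_repr_mem]
    intro i
    exact ⟨k i, by simp⟩
  let g : Lat d → L := fun k => ⟨fun i => (k i : ℝ), hmem k⟩
  have hg : Function.Injective g := by
    intro a b hab
    have h := congrArg Subtype.val hab
    funext i
    have h2 : (a i : ℝ) = (b i : ℝ) := congrFun h i
    exact_mod_cast h2
  have hS' := hS.comp_injective hg
  refine Summable.of_norm_bounded_eventually hS' ?_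
  refine (Set.finite_singleton (0 : Lat d)).subset ?_
  intro k hk
  by_contra hne
  apply hk
  have hgk : g k ≠ 0 := by
    intro h
    apply hne
    have h0 : g 0 = 0 := by
      apply Subtype.ext
      funext i
      simp [g]
    exact hg (h.trans h0.symm)
  have hpos : 0 < ‖g k‖ := norm_pos_iff.mpr hgk
  have hle : ‖g k‖ ≤ jap k := by
    change ‖(fun i => (k i : ℝ))‖ ≤ jap k
    rw [pi_norm_le_iff_of_nonneg (jap_pos k).le]
    intro i
    exact abs_le_jap k i
  change ‖jap k ^ r‖ ≤ ‖g k‖ ^ r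
  rw [Real.norm_of_nonneg (Real.rpow_nonneg (jap_pos k).le _)]
  apply Real.rpow_le_rpow_of_nonpos hpos hle
  have : (0 : ℝ) ≤ d := by positivity
  linarith

open scoped ENNReal in
theorem cs_tsum {ι : Type*} (a b : ι → ℝ≥0∞) :
    (∑' i, a i * b i) ^ 2 ≤ (∑' i, a i ^ 2) * ∑' i, b i ^ 2 := by
  let _ : MeasurableSpace ι := ⊤
  have h := ENNReal.lintegral_mul_le_Lp_mul_Lq (Measure.count : Measure ι)
    Real.HolderConjugate.two_two (f := a) (g := b) (measurable_from_top.aemeasurable)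
    (measurable_from_top.aemeasurable)
  simp only [lintegral_count, Pi.mul_apply, ENNReal.rpow_two] at h
  calc _ ≤ _ := pow_le_pow_left₀ (zero_le) h 2
    _ = _ := by
      rw [mul_pow]
      simp only [← ENNReal.rpow_natCast, ← ENNReal.rpow_mul]
      norm_num

open scoped ENNReal in
theorem conv_bound {d : ℕ} (w A B : Lat d → ℝ≥0∞) :
    ∑' k, (∑' l, (w l + w k) * (A l * B (k - l))) ^ 2
      ≤ 4 * ((∑' k, w k ^ 2) * (∑' k, A k ^ 2) * ∑' k, B k ^ 2) := by
  have hB : ∀ l : Lat d, ∑' k, B (k - l) ^ 2 = ∑' k, B k ^ 2 := fun l =>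
    (Equiv.subRight l).tsum_eq (fun k => B k ^ 2)
  have hB' : ∀ k : Lat d, ∑' l, B (k - l) ^ 2 = ∑' k, B k ^ 2 := fun k =>
    (Equiv.subLeft k).tsum_eq (fun k => B k ^ 2)
  have hsq : ∀ x y : ℝ≥0∞, (x + y) ^ 2 ≤ 2 * (x ^ 2 + y ^ 2) := by
    intro x y
    have := ENNReal.rpow_add_le_mul_rpow_add_rpow x y (p := 2) (by norm_num)
    norm_num at this
    simpa using this
  have hk : ∀ k, (∑' l, (w l + w k) * (A l * B (k - l))) ^ 2 ≤
      2 * ((∑' l, w l ^ 2) * (∑' l, A l ^ 2 * B (k - l) ^ 2) +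
        w k ^ 2 * ((∑' k, A k ^ 2) * ∑' k, B k ^ 2)) := by
    intro k
    simp only [add_mul]
    rw [ENNReal.tsum_add, ENNReal.tsum_mul_left]
    refine (hsq _ _).trans ?_
    gcongr
    · refine (cs_tsum _ _).trans (le_of_eq ?_)
      simp only [mul_pow]
    · rw [mul_pow]
      gcongr
      refine (cs_tsum _ _).trans (le_of_eq ?_)
      rw [hB']
  calc _ ≤ _ := ENNReal.tsum_le_tsum hk
    _ = _ := by
      rw [ENNReal.tsum_mul_left, ENNReal.tsum_add, ENNReal.tsum_mul_left, ENNReal.tsum_mul_right,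
        ENNReal.tsum_comm]
      simp only [ENNReal.tsum_mul_left, hB, ENNReal.tsum_mul_right]
      ring

theorem norm_eChar {d : ℕ} (k : Lat d) (x : Fin d → ℝ) : ‖eChar k x‖ = 1 := by
  unfold eChar
  have : (2 * (Real.pi : ℂ) * Complex.I * ∑ i, (k i : ℂ) * (x i : ℂ))
      = ((2 * Real.pi * ∑ i, (k i : ℝ) * x i : ℝ) : ℂ) * Complex.I := by
    push_cast
    ring
  rw [this, Complex.norm_exp_ofReal_mul_I]

theorem fCoef_bound {d : ℕ} (K : (Fin d → ℝ) → Fin d → ℝ)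
    (hK : ∀ j, IntegrableOn (fun x => K x j) (box d)) (j : Fin d) (k : Lat d) :
    ‖fCoef (fun x => (K x j : ℂ)) k‖ ≤ ∫ x in box d, Real.sqrt (∑ j, K x j ^ 2) := by
  unfold fCoef
  have hint : Integrable (fun x => Real.sqrt (∑ j, K x j ^ 2)) (volume.restrict (box d)) := by
    refine Integrable.mono' (g := fun x => ∑ j, |K x j|)
      (integrable_finsetSum _ fun j _ => (hK j).abs) ?_ ?_
    · apply Real.continuous_sqrt.comp_aestronglyMeasurable
      apply Finset.aestronglyMeasurable_fun_sum
      intro j _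
      exact (hK j).aestronglyMeasurable.pow 2
    · refine Eventually.of_forall fun x => ?_
      rw [Real.norm_of_nonneg (Real.sqrt_nonneg _)]
      apply Real.sqrt_le_iff.mpr
      refine ⟨by positivity, ?_⟩
      simpa using Finset.sum_sq_le_sq_sum_of_nonneg (s := Finset.univ) (f := fun j => |K x j|)
        (fun j _ => abs_nonneg _)
  apply norm_integral_le_of_norm_le hint
  refine Eventually.of_forall fun x => ?_
  rw [norm_mul, norm_eChar, mul_one, Complex.norm_real, Real.norm_eq_abs]
  apply Real.abs_le_sqrt
  exact Finset.single_le_sum (f := fun j => K x j ^ 2) (fun i _ => sq_nonneg _) (Finset.mem_univ j)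

theorem tsum_ofReal_sq {ι : Type*} (a : ι → ℝ) (h0 : ∀ i, 0 ≤ a i)
    (h : Summable fun i => a i ^ 2) :
    ∑' i, ENNReal.ofReal (a i) ^ 2 = ENNReal.ofReal (∑' i, a i ^ 2) := by
  rw [ENNReal.ofReal_tsum_of_nonneg (fun i => sq_nonneg _) h]
  simp only [ENNReal.ofReal_pow (h0 _)]

/-- Real-variable form of the convolution bound. -/
theorem conv_real {d : ℕ} (w A B : Lat d → ℝ) (hw : ∀ k, 0 ≤ w k) (hA : ∀ k, 0 ≤ A k)
    (hB : ∀ k, 0 ≤ B k) (sw : Summable fun k => w k ^ 2) (sA : Summable fun k => A k ^ 2)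
    (sB : Summable fun k => B k ^ 2) :
    (∀ k, Summable fun l => (w l + w k) * (A l * B (k - l))) ∧
    (Summable fun k => (∑' l, (w l + w k) * (A l * B (k - l))) ^ 2) ∧
    ∑' k, (∑' l, (w l + w k) * (A l * B (k - l))) ^ 2
      ≤ 4 * ((∑' k, w k ^ 2) * (∑' k, A k ^ 2) * ∑' k, B k ^ 2) := by
  have hb := conv_bound (fun k => ENNReal.ofReal (w k)) (fun k => ENNReal.ofReal (A k))
    (fun k => ENNReal.ofReal (B k))
  rw [tsum_ofReal_sq w hw sw, tsum_ofReal_sq A hA sA, tsum_ofReal_sq B hB sB] at hb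
  have hnn : ∀ k l, 0 ≤ (w l + w k) * (A l * B (k - l)) := fun k l =>
    mul_nonneg (add_nonneg (hw _) (hw _)) (mul_nonneg (hA _) (hB _))
  have hterm : ∀ k l, (ENNReal.ofReal (w l) + ENNReal.ofReal (w k)) *
      (ENNReal.ofReal (A l) * ENNReal.ofReal (B (k - l))) =
      ENNReal.ofReal ((w l + w k) * (A l * B (k - l))) := by
    intro k l
    rw [ENNReal.ofReal_mul (add_nonneg (hw _) (hw _)), ENNReal.ofReal_mul (hA _),
      ENNReal.ofReal_add (hw _) (hw _)]
  simp only [hterm] at hb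
  have h4 : (4 : ENNReal) = ENNReal.ofReal 4 := by norm_num
  have tw : 0 ≤ ∑' k, w k ^ 2 := tsum_nonneg fun _ => sq_nonneg _
  have tA : 0 ≤ ∑' k, A k ^ 2 := tsum_nonneg fun _ => sq_nonneg _
  have tB : 0 ≤ ∑' k, B k ^ 2 := tsum_nonneg fun _ => sq_nonneg _
  rw [h4, ← ENNReal.ofReal_mul tw, ← ENNReal.ofReal_mul (mul_nonneg tw tA),
    ← ENNReal.ofReal_mul (by norm_num)] at hb
  have hfin := ne_top_of_le_ne_top ENNReal.ofReal_ne_top hb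
  have hS : ∀ k, Summable fun l => (w l + w k) * (A l * B (k - l)) := by
    intro k
    have h1 := ENNReal.ne_top_of_tsum_ne_top hfin k
    have h2 : ∑' l, ENNReal.ofReal ((w l + w k) * (A l * B (k - l))) ≠ ⊤ := by
      intro h
      rw [h] at h1
      simp at h1
    have h3 := ENNReal.summable_toReal h2
    simpa only [ENNReal.toReal_ofReal (hnn k _)] using h3
  have hin : ∀ k, ∑' l, ENNReal.ofReal ((w l + w k) * (A l * B (k - l))) =
      ENNReal.ofReal (∑' l, (w l + w k) * (A l * B (k - l))) := fun k =>
    (ENNReal.ofReal_tsum_of_nonneg (hnn k) (hS k)).symm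
  have hg : ∀ k, 0 ≤ ∑' l, (w l + w k) * (A l * B (k - l)) := fun k => tsum_nonneg (hnn k)
  simp only [hin, ← ENNReal.ofReal_pow (hg _)] at hb hfin
  have hS2 : Summable fun k => (∑' l, (w l + w k) * (A l * B (k - l))) ^ 2 := by
    have h3 := ENNReal.summable_toReal hfin
    simpa only [ENNReal.toReal_ofReal (sq_nonneg _)] using h3
  refine ⟨hS, hS2, ?_⟩
  rw [← ENNReal.ofReal_tsum_of_nonneg (fun k => sq_nonneg _) hS2] at hb
  rwa [ENNReal.ofReal_le_ofReal_iff (by positivity)] at hb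

/-- for `d ≥ 1`, `λ > 3d/2`, `λ' > λ+1` there is `C = C(d,λ,λ') > 0` such
that for every `μ ∈ H^{λ'}(𝕋^d)`, every kernel `K ∈ L¹(𝕋^d; ℝ^d)` and every
`f ∈ H^{-λ-1}(𝕋^d)`, the distribution `∇·(μ (K*f))` belongs to `H^{-λ-2}(𝕋^d)` and
`‖∇·(μ (K*f))‖_{H^{-λ-2}} ≤ C ‖μ‖_{H^{λ'}} ‖f‖_{H^{-λ-1}} ‖K‖_{L¹}`.
Here `⟨K*f, e_k⟩ = (∫ K e_k) ⟨f, e_k⟩` componentwise, and the product with `μ` and the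
divergence are taken via `prodCoef` and `divCoef`. -/
theorem statement0
    (d : ℕ) (hd : 1 ≤ d) (lam lam' : ℝ)
    (hlam : 3 * (d : ℝ) / 2 < lam) (hlam' : lam + 1 < lam') :
    ∃ C : ℝ, 0 < C ∧
      ∀ (μ : Coef d) (K : (Fin d → ℝ) → Fin d → ℝ) (f : Coef d),
        MemSob lam' μ → TorusFun K →
        (∀ j, IntegrableOn (fun x => K x j) (box d)) →
        MemSob (-(lam + 1)) f →
        (∀ (j : Fin d) (k : Lat d),
            Summable fun l : Lat d =>
              μ l * (fCoef (fun x => (K x j : ℂ)) (k - l) * f (k - l))) ∧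
        MemSob (-(lam + 2))
          (divCoef fun j => prodCoef μ fun m => fCoef (fun x => (K x j : ℂ)) m * f m) ∧
        sobNorm (-(lam + 2))
            (divCoef fun j => prodCoef μ fun m => fCoef (fun x => (K x j : ℂ)) m * f m)
          ≤ C * sobNorm lam' μ * sobNorm (-(lam + 1)) f *
              ∫ x in box d, Real.sqrt (∑ j, K x j ^ 2) := by
  have hd0 : (0 : ℝ) ≤ d := by positivity
  obtain ⟨s, hs⟩ : ∃ s, s = lam + 1 := ⟨_, rfl⟩
  have hs0 : 0 ≤ s := by linarith
  have e2 : ∀ (k : Lat d) (r : ℝ), (jap k ^ r) ^ 2 = jap k ^ (2 * r) := by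
    intro k r
    rw [← Real.rpow_natCast, ← Real.rpow_mul (jap_pos k).le]
    congr 1
    push_cast
    ring
  have sw : Summable fun k : Lat d => (jap k ^ (-s)) ^ 2 := by
    simp only [e2]
    exact summable_jap d (by linarith)
  obtain ⟨S, hS⟩ : ∃ S, S = ∑' k : Lat d, (jap k ^ (-s)) ^ 2 := ⟨_, rfl⟩
  have hSn : 0 ≤ S := hS ▸ tsum_nonneg fun _ => sq_nonneg _
  obtain ⟨M, hM⟩ : ∃ M : ℝ, M = d * (2 * Real.pi) * 2 ^ s := ⟨_, rfl⟩
  have hMn : 0 ≤ M := by rw [hM]; positivity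
  refine ⟨M * 2 * Real.sqrt S + 1, by positivity, ?_⟩
  intro μ K f hμ hT hK hf
  rw [← hs] at hf
  obtain ⟨κ, hκ⟩ : ∃ κ, κ = ∫ x in box d, Real.sqrt (∑ j, K x j ^ 2) := ⟨_, rfl⟩
  have hκn : 0 ≤ κ := hκ ▸ integral_nonneg fun _ => Real.sqrt_nonneg _
  have hF : ∀ j k, ‖fCoef (fun x => (K x j : ℂ)) k‖ ≤ κ := fun j k => hκ ▸ fCoef_bound K hK j k
  rw [← hκ]
  have hAle : ∀ k, (jap k ^ s * ‖μ k‖) ^ 2 ≤ jap k ^ (2 * lam') * ‖μ k‖ ^ 2 := by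
    intro k
    rw [mul_pow, e2]
    gcongr
    · exact one_le_jap k
    · linarith
  have sA : Summable fun k => (jap k ^ s * ‖μ k‖) ^ 2 :=
    Summable.of_nonneg_of_le (fun _ => sq_nonneg _) hAle hμ
  have eB : ∀ k, (jap k ^ (-s) * ‖f k‖) ^ 2 = jap k ^ (2 * (-s)) * ‖f k‖ ^ 2 := by
    intro k
    rw [mul_pow, e2]
  have sB : Summable fun k => (jap k ^ (-s) * ‖f k‖) ^ 2 := by
    simp only [eB]
    exact hf
  have hp : ∀ (k : Lat d) (r : ℝ), 0 < jap k ^ r := fun k r => Real.rpow_pos_of_pos (jap_pos k) r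
  obtain ⟨c1, c2, c3⟩ := conv_real (fun k : Lat d => jap k ^ (-s)) (fun k => jap k ^ s * ‖μ k‖)
    (fun k => jap k ^ (-s) * ‖f k‖) (fun k => (hp k _).le)
    (fun k => mul_nonneg (hp k _).le (norm_nonneg _))
    (fun k => mul_nonneg (hp k _).le (norm_nonneg _)) sw sA sB
  obtain ⟨T, hTd⟩ : ∃ T : Lat d → Lat d → ℝ, T = fun k l => (jap l ^ (-s) + jap k ^ (-s)) *
    ((jap l ^ s * ‖μ l‖) * (jap (k - l) ^ (-s) * ‖f (k - l)‖)) := ⟨_, rfl⟩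
  have hTe : ∀ k l, (jap l ^ (-s) + jap k ^ (-s)) *
    ((jap l ^ s * ‖μ l‖) * (jap (k - l) ^ (-s) * ‖f (k - l)‖)) = T k l := by
    intro k l
    rw [hTd]
  simp only [hTe, ← hS] at c1 c2 c3
  have hpt : ∀ k l, ‖μ l‖ * ‖f (k - l)‖ ≤ 2 ^ s * jap k ^ s * T k l := by
    intro k l
    rw [← hTe]
    have h := jap_sub_rpow_le k l hs0
    simp only [Real.rpow_neg (jap_pos _).le]
    have hx := hp k s
    have hy := hp l s
    have hz := hp (k - l) s
    have e : 2 ^ s * jap k ^ s * (((jap l ^ s)⁻¹ + (jap k ^ s)⁻¹) *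
        (jap l ^ s * ‖μ l‖ * ((jap (k - l) ^ s)⁻¹ * ‖f (k - l)‖))) =
        (2 ^ s * (jap k ^ s + jap l ^ s) / jap (k - l) ^ s) * (‖μ l‖ * ‖f (k - l)‖) := by
      field_simp
    rw [e]
    apply le_mul_of_one_le_left (by positivity)
    rwa [one_le_div hz]
  have hterm : ∀ j k l, ‖μ l * (fCoef (fun x => (K x j : ℂ)) (k - l) * f (k - l))‖ ≤
      (κ * (2 ^ s * jap k ^ s)) * T k l := by
    intro j k l
    rw [norm_mul, norm_mul]
    calc _ = ‖fCoef (fun x => (K x j : ℂ)) (k - l)‖ * (‖μ l‖ * ‖f (k - l)‖) := by ring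
      _ ≤ κ * (2 ^ s * jap k ^ s * T k l) :=
        mul_le_mul (hF _ _) (hpt k l) (by positivity) hκn
      _ = _ := by ring
  have hprod : ∀ j k, ‖prodCoef μ (fun m => fCoef (fun x => (K x j : ℂ)) m * f m) k‖ ≤
      (κ * (2 ^ s * jap k ^ s)) * ∑' l, T k l := by
    intro j k
    unfold prodCoef
    rw [← tsum_mul_left]
    exact tsum_of_norm_bounded ((c1 k).mul_left _).hasSum (hterm j k)
  have hdiv : ∀ k, ‖divCoef (fun j => prodCoef μ fun m => fCoef (fun x => (K x j : ℂ)) m * f m) k‖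
      ≤ M * κ * (jap k ^ (s + 1) * ∑' l, T k l) := by
    intro k
    unfold divCoef pderivCoef
    have hj : ∀ j ∈ (Finset.univ : Finset (Fin d)), ‖-(2 * (Real.pi : ℂ) * Complex.I * (k j : ℂ)) *
        prodCoef μ (fun m => fCoef (fun x => (K x j : ℂ)) m * f m) k‖ ≤
        (2 * Real.pi * jap k) * ((κ * (2 ^ s * jap k ^ s)) * ∑' l, T k l) := by
      intro j _
      rw [norm_mul]
      refine mul_le_mul ?_ (hprod j k) (norm_nonneg _) ?_
      · have := abs_le_jap k j
        simp only [norm_neg, norm_mul, Complex.norm_I, mul_one, Complex.norm_real,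
          Complex.norm_intCast, Complex.norm_ofNat, Real.norm_eq_abs, abs_of_pos Real.pi_pos]
        gcongr
      · have := jap_pos k
        positivity
    refine (norm_sum_le_of_le _ hj).trans (le_of_eq ?_)
    rw [Finset.sum_const, Finset.card_univ, Fintype.card_fin, nsmul_eq_mul, hM,
      Real.rpow_add_one (jap_pos k).ne']
    ring
  have hfinal : ∀ k, jap k ^ (2 * (-(lam + 2))) *
      ‖divCoef (fun j => prodCoef μ fun m => fCoef (fun x => (K x j : ℂ)) m * f m) k‖ ^ 2
      ≤ (M * κ) ^ 2 * (∑' l, T k l) ^ 2 := by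
    intro k
    have h1 : -(lam + 2) = -(s + 1) := by rw [hs]; ring
    rw [h1, ← e2, ← mul_pow, ← mul_pow]
    refine pow_le_pow_left₀ (mul_nonneg (hp k _).le (norm_nonneg _)) ?_ 2
    calc _ ≤ jap k ^ (-(s + 1)) * (M * κ * (jap k ^ (s + 1) * ∑' l, T k l)) :=
          mul_le_mul_of_nonneg_left (hdiv k) (hp k _).le
      _ = _ := by
        rw [Real.rpow_neg (jap_pos k).le]
        have := (hp k (s + 1)).ne'
        field_simp
  have hmem : MemSob (-(lam + 2))
      (divCoef fun j => prodCoef μ fun m => fCoef (fun x => (K x j : ℂ)) m * f m) :=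
    Summable.of_nonneg_of_le (fun k => mul_nonneg (hp k _).le (sq_nonneg _)) hfinal
      (c2.mul_left _)
  refine ⟨fun j k => Summable.of_norm_bounded ((c1 k).mul_left _) (hterm j k), hmem, ?_⟩
  have hNμ : 0 ≤ sobNorm lam' μ := Real.sqrt_nonneg _
  have hNf : 0 ≤ sobNorm (-(lam + 1)) f := Real.sqrt_nonneg _
  have hA2 : ∑' k, (jap k ^ s * ‖μ k‖) ^ 2 ≤ sobNorm lam' μ ^ 2 := by
    unfold sobNorm
    rw [Real.sq_sqrt (tsum_nonneg fun k => mul_nonneg (hp k _).le (sq_nonneg _))]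
    exact sA.tsum_le_tsum hAle hμ
  have hB2 : ∑' k, (jap k ^ (-s) * ‖f k‖) ^ 2 = sobNorm (-(lam + 1)) f ^ 2 := by
    unfold sobNorm
    rw [Real.sq_sqrt (tsum_nonneg fun k => mul_nonneg (hp k _).le (sq_nonneg _)), ← hs]
    simp only [eB]
  have hmain : sobNorm (-(lam + 2))
      (divCoef fun j => prodCoef μ fun m => fCoef (fun x => (K x j : ℂ)) m * f m) ≤
      (M * 2 * Real.sqrt S) * sobNorm lam' μ * sobNorm (-(lam + 1)) f * κ := by
    conv_lhs => unfold sobNorm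
    apply Real.sqrt_le_iff.mpr
    refine ⟨by positivity, ?_⟩
    calc _ ≤ ∑' k, (M * κ) ^ 2 * (∑' l, T k l) ^ 2 := hmem.tsum_le_tsum hfinal (c2.mul_left _)
      _ = (M * κ) ^ 2 * ∑' k, (∑' l, T k l) ^ 2 := tsum_mul_left
      _ ≤ (M * κ) ^ 2 * (4 * (S * sobNorm lam' μ ^ 2 * sobNorm (-(lam + 1)) f ^ 2)) := by
        refine mul_le_mul_of_nonneg_left (c3.trans ?_) (sq_nonneg _)
        rw [hB2]
        gcongr
      _ = _ := by
        nth_rewrite 1 [← Real.sq_sqrt hSn]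
        ring
  refine hmain.trans ?_
  gcongr
  linarith

end PaperTorus
end
end

section
/- Let d ≥ 1 and s > d/2. There exists a constant C, depending only on d and s, such that for every n ∈ ℤ^d: Σ_{l∈ℤ^d} (1 + |l|² + |n − l|²)^{−s} ≤ C (1 + |n|²)^{(d − 2s)/2}. -/
open scoped BigOperators

noncomputable section
namespace PaperTorus

lemma hasSum_pi {f : ℤ → ℝ} (hf : ∀ k, 0 ≤ f k) {S : ℝ} (h : HasSum f S) (d : ℕ) :
    HasSum (fun l : Fin d → ℤ => ∏ i, f (l i)) (S ^ d) := by
  induction d with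
  | zero => simp
  | succ d ih =>
    have hg : (0 : (Fin d → ℤ) → ℝ) ≤ fun l => ∏ i, f (l i) :=
      fun l => Finset.prod_nonneg fun i _ => hf _
    have hf' : (0 : ℤ → ℝ) ≤ f := hf
    have hsm := Summable.mul_of_nonneg h.summable ih.summable hf' hg
    have h2 := HasSum.mul h ih hsm
    rw [← (Fin.consEquiv (fun _ : Fin (d+1) => ℤ)).hasSum_iff, pow_succ']
    have e : ((fun l : Fin (d+1) → ℤ => ∏ i, f (l i)) ∘ (Fin.consEquiv (fun _ : Fin (d+1) => ℤ)))
        = fun p : ℤ × (Fin d → ℤ) => f p.1 * ∏ i, f (p.2 i) := by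
      funext p
      simp [Fin.consEquiv, Fin.prod_univ_succ]
    rw [e]
    exact h2

lemma summable_base {a : ℝ} (ha : 1 / 2 < a) :
    Summable (fun q : ℤ => (1 + (q : ℝ) ^ 2) ^ (-a)) := by
  have h := (Real.summable_one_div_int_add_rpow (1/2) (2 * a)).2 (by linarith)
  refine Summable.of_nonneg_of_le (fun q => by positivity) (fun q => ?_) (h.mul_left (2 ^ a))
  have hne : (q : ℝ) + 1 / 2 ≠ 0 := by
    intro h0
    have h1 : (2 * q + 1 : ℝ) = 0 := by linarith
    have h2 : 2 * q + 1 = 0 := by exact_mod_cast h1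
    omega
  have hpos : 0 < |(q : ℝ) + 1 / 2| := abs_pos.2 hne
  have e : |(q : ℝ) + 1 / 2| ^ (2 * a) = (|(q : ℝ) + 1 / 2| ^ 2) ^ a := by
    rw [Real.rpow_mul hpos.le]; norm_num
  rw [e, Real.rpow_neg (by positivity), mul_one_div, ← Real.div_rpow (by norm_num) (by positivity),
    ← Real.inv_rpow (by positivity)]
  refine Real.rpow_le_rpow (by positivity) ?_ (by linarith)
  rw [inv_eq_one_div, div_le_div_iff₀ (by positivity) (by positivity), sq_abs]
  nlinarith [sq_nonneg ((q : ℝ) - 1 / 2)]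

lemma one_dim {a : ℝ} (ha : 1 / 2 < a) :
    ∃ C : ℝ, 0 < C ∧ ∀ x : ℝ, 1 ≤ x →
      Summable (fun k : ℤ => (x + (k : ℝ) ^ 2) ^ (-a)) ∧
      ∑' k : ℤ, (x + (k : ℝ) ^ 2) ^ (-a) ≤ C * x ^ ((1 - 2 * a) / 2) := by
  have hS := (summable_base ha).hasSum
  set S := ∑' q : ℤ, (1 + (q : ℝ) ^ 2) ^ (-a) with hSdef
  have hSpos : 0 < S := (summable_base ha).tsum_pos (fun q => by positivity) 0 (by simp)
  refine ⟨3 ^ a * (1 / 2 : ℝ) ^ (1 - 2 * a) * S, by positivity, fun x hx => ?_⟩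
  have hx0 : 0 < x := by linarith
  set R := √x with hR
  have hR1 : 1 ≤ R := Real.one_le_sqrt.2 hx
  have hRx : R ^ 2 = x := Real.sq_sqrt hx0.le
  set m := ⌊R⌋₊ with hm
  have hm1 : 1 ≤ m := Nat.le_floor (by simpa using hR1)
  have hm1' : (1 : ℝ) ≤ m := by exact_mod_cast hm1
  have hmR : (m : ℝ) ≤ R := Nat.floor_le (by linarith)
  have hRm : R < m + 1 := Nat.lt_floor_add_one R
  have : NeZero m := ⟨by omega⟩
  have hone : HasSum (fun _ : Fin m => (1 : ℝ)) m := by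
    simpa using hasSum_fintype (fun _ : Fin m => (1 : ℝ))
  have hprod := hS.mul hone ((summable_base ha).mul_of_nonneg hone.summable
      (fun q => by positivity) (fun _ => by norm_num))
  have hprod2 := ((Int.divModEquiv m).hasSum_iff.2 hprod).mul_left ((3 : ℝ) ^ a * ((m : ℝ) ^ 2) ^ (-a))
  have hle : ∀ k : ℤ, (x + (k : ℝ) ^ 2) ^ (-a) ≤ (3 : ℝ) ^ a * ((m : ℝ) ^ 2) ^ (-a) *
      (((fun p : ℤ × Fin m => (1 + (p.1 : ℝ) ^ 2) ^ (-a) * (1 : ℝ)) ∘ (Int.divModEquiv m)) k) := by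
    intro k
    have hk1 : ((Int.divModEquiv m) k).1 = k / (m : ℤ) := rfl
    simp only [Function.comp, hk1, mul_one]
    set q := k / (m : ℤ) with hq
    have hdm : (m : ℤ) * q + k % m = k := Int.mul_ediv_add_emod k m
    have hr0 : 0 ≤ k % (m : ℤ) := Int.emod_nonneg _ (by omega)
    have hr1 : k % (m : ℤ) < m := Int.emod_lt_of_pos _ (by omega)
    set r := k % (m : ℤ)
    have hdm' : (m : ℝ) * q + r = k := by exact_mod_cast hdm
    have hr0' : (0 : ℝ) ≤ r := by exact_mod_cast hr0
    have hr1' : (r : ℝ) ≤ m := by exact_mod_cast hr1.le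
    have key : (m : ℝ) ^ 2 * (1 + (q : ℝ) ^ 2) ≤ 3 * (x + (k : ℝ) ^ 2) := by
      have e1 : (m : ℝ) * q = k - r := by linarith
      have e2 : (m : ℝ) ^ 2 * (q : ℝ) ^ 2 = (k - r) ^ 2 := by rw [← e1]; ring
      have e3 : (r : ℝ) ^ 2 ≤ m ^ 2 := by gcongr
      have e4 : (m : ℝ) ^ 2 ≤ x := by rw [← hRx]; gcongr
      nlinarith [sq_nonneg ((k : ℝ) + r), sq_nonneg (k : ℝ)]
    have h3 : (3 : ℝ) ^ a = (1 / 3 : ℝ) ^ (-a) := by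
      rw [Real.rpow_neg (by norm_num), ← Real.inv_rpow (by norm_num)]; norm_num
    rw [h3, ← Real.mul_rpow (by positivity) (by positivity),
      ← Real.mul_rpow (by positivity) (by positivity)]
    exact Real.rpow_le_rpow_of_nonpos (by positivity) (by linarith) (by linarith)
  have hsum : Summable (fun k : ℤ => (x + (k : ℝ) ^ 2) ^ (-a)) :=
    Summable.of_nonneg_of_le (fun k => by positivity) hle hprod2.summable
  refine ⟨hsum, (hasSum_le hle hsum.hasSum hprod2).trans ?_⟩
  have e1 : ((m : ℝ) ^ 2) ^ (-a) * m = (m : ℝ) ^ (1 - 2 * a) := by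
    rw [← Real.rpow_natCast, ← Real.rpow_mul (by positivity), ← Real.rpow_add_one (by positivity)]
    congr 1; push_cast; ring
  have e2 : x ^ ((1 - 2 * a) / 2) = R ^ (1 - 2 * a) := by
    rw [← hRx, ← Real.rpow_natCast, ← Real.rpow_mul (by positivity)]
    congr 1; push_cast; ring
  have e3 : (m : ℝ) ^ (1 - 2 * a) ≤ (1 / 2 : ℝ) ^ (1 - 2 * a) * R ^ (1 - 2 * a) := by
    rw [← Real.mul_rpow (by positivity) (by positivity)]
    exact Real.rpow_le_rpow_of_nonpos (by positivity) (by linarith) (by linarith)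
  calc (3 : ℝ) ^ a * ((m : ℝ) ^ 2) ^ (-a) * (S * m)
      = 3 ^ a * S * (((m : ℝ) ^ 2) ^ (-a) * m) := by ring
    _ ≤ 3 ^ a * S * ((1 / 2 : ℝ) ^ (1 - 2 * a) * R ^ (1 - 2 * a)) := by rw [e1]; gcongr
    _ = _ := by rw [e2]; ring

/-- let `d ≥ 1` and `s > d/2`.  There is `C = C(d,s) > 0` such that for
every `n ∈ ℤ^d`,
`Σ_{l ∈ ℤ^d} (1 + |l|² + |n−l|²)^{-s} ≤ C (1 + |n|²)^{(d−2s)/2}`. -/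
theorem statement9
    (d : ℕ) (hd : 1 ≤ d) (s : ℝ) (hs : (d : ℝ) / 2 < s) :
    ∃ C : ℝ, 0 < C ∧
      ∀ n : Lat d,
        Summable (fun l : Lat d =>
          (1 + ∑ i, ((l i : ℝ)) ^ 2 + ∑ i, ((n i : ℝ) - (l i : ℝ)) ^ 2) ^ (-s)) ∧
        (∑' l : Lat d,
            (1 + ∑ i, ((l i : ℝ)) ^ 2 + ∑ i, ((n i : ℝ) - (l i : ℝ)) ^ 2) ^ (-s))
          ≤ C * (1 + ∑ i, ((n i : ℝ)) ^ 2) ^ (((d : ℝ) - 2 * s) / 2) := by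
  have hd0 : (0 : ℝ) < d := by exact_mod_cast hd
  set a := s / d with ha_def
  have had : a * d = s := div_mul_cancel₀ _ hd0.ne'
  have ha : 1 / 2 < a := by rw [ha_def, lt_div_iff₀ hd0]; linarith
  obtain ⟨C, hC, h1⟩ := one_dim ha
  refine ⟨(3 ^ a * C) ^ d, by positivity, fun n => ?_⟩
  set x : ℝ := 1 + ∑ i, ((n i : ℝ)) ^ 2 with hx_def
  have hx : 1 ≤ x := by
    have : 0 ≤ ∑ i, ((n i : ℝ)) ^ 2 := by positivity
    linarith
  obtain ⟨hs1, hs2⟩ := h1 x hx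
  have hP := hasSum_pi (fun k => by positivity) (hs1.hasSum.mul_left ((3 : ℝ) ^ a)) d
  have hle : ∀ l : Lat d,
      (1 + ∑ i, ((l i : ℝ)) ^ 2 + ∑ i, ((n i : ℝ) - (l i : ℝ)) ^ 2) ^ (-s) ≤
      ∏ i, ((3 : ℝ) ^ a * (x + (l i : ℝ) ^ 2) ^ (-a)) := by
    intro l
    set A : ℝ := 1 + ∑ i, ((l i : ℝ)) ^ 2 + ∑ i, ((n i : ℝ) - (l i : ℝ)) ^ 2 with hA
    have hApos : 0 < A := by positivity
    have e : A ^ (-s) = ∏ _i : Fin d, A ^ (-a) := by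
      rw [Finset.prod_const, Finset.card_univ, Fintype.card_fin, ← Real.rpow_natCast,
        ← Real.rpow_mul hApos.le, ← had]
      congr 1; ring
    rw [e]
    refine Finset.prod_le_prod (fun i _ => by positivity) (fun i _ => ?_)
    have h3 : (3 : ℝ) ^ a = (1 / 3 : ℝ) ^ (-a) := by
      rw [Real.rpow_neg (by norm_num), ← Real.inv_rpow (by norm_num)]; norm_num
    rw [h3, ← Real.mul_rpow (by positivity) (by positivity)]
    refine Real.rpow_le_rpow_of_nonpos (by positivity) ?_ (by linarith)
    have f1 : (l i : ℝ) ^ 2 ≤ ∑ i, ((l i : ℝ)) ^ 2 :=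
      Finset.single_le_sum (f := fun i => ((l i : ℝ)) ^ 2) (fun j _ => by positivity)
        (Finset.mem_univ i)
    have f2 : ∑ i, ((n i : ℝ)) ^ 2 ≤
        2 * ∑ i, ((l i : ℝ)) ^ 2 + 2 * ∑ i, ((n i : ℝ) - (l i : ℝ)) ^ 2 := by
      rw [Finset.mul_sum, Finset.mul_sum, ← Finset.sum_add_distrib]
      refine Finset.sum_le_sum fun j _ => ?_
      nlinarith [sq_nonneg ((n j : ℝ) - 2 * l j)]
    have f3 : 0 ≤ ∑ i, ((n i : ℝ) - (l i : ℝ)) ^ 2 := by positivity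
    rw [hx_def, hA]
    linarith
  have hsum := Summable.of_nonneg_of_le (fun l => by positivity) hle hP.summable
  refine ⟨hsum, (hasSum_le hle hsum.hasSum hP).trans ?_⟩
  have hT : 0 ≤ ∑' k : ℤ, (x + (k : ℝ) ^ 2) ^ (-a) := tsum_nonneg fun k => by positivity
  calc _ ≤ (3 ^ a * (C * x ^ ((1 - 2 * a) / 2))) ^ d := by gcongr
    _ = (3 ^ a * C) ^ d * (x ^ ((1 - 2 * a) / 2)) ^ d := by rw [← mul_pow, mul_assoc]
    _ = _ := by
      rw [← Real.rpow_natCast (x ^ ((1 - 2 * a) / 2)), ← Real.rpow_mul (by linarith)]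
      congr 2
      rw [← had]; ring

end PaperTorus
end
end

section
/- (Gyöngy–Krylov criterion) Let (X_n)_{n∈ℕ} be a sequence of random variables from a probability space (Ω, 𝓕, ℙ) to a complete separable metric space (E, d). Assume that for every pair of subsequences (n₁(k), n₂(k))_{k∈ℕ} with n₁(k) ≥ n₂(k) for every k, there exists a further subsequence (k(h))_{h∈ℕ} such that the E×E-valued random variables (X_{n₁(k(h))}, X_{n₂(k(h))})_{h∈ℕ} converge in distribution to a probability measure μ on E×E satisfying μ(D) = 1, where D = {(x,x) : x ∈ E} is the diagonal. Then there exists a random variable X : (Ω, 𝓕, ℙ) → (E, d) such that X_n → X in probability. -/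
open MeasureTheory Filter
open scoped BigOperators

noncomputable section
namespace PaperProb

/-- The truncated distance as a bounded continuous function on `E × E`. -/
def truncDist (E : Type*) [MetricSpace E] : BoundedContinuousFunction (E × E) ℝ :=
  BoundedContinuousFunction.ofNormedAddCommGroup (fun p : E × E => min 1 (dist p.1 p.2))
    (by fun_prop) 1 (by
      intro p
      rw [Real.norm_of_nonneg (le_min zero_le_one dist_nonneg)]
      exact min_le_left _ _)

lemma truncDist_apply {E : Type*} [MetricSpace E] (x y : E) :
    truncDist E (x, y) = min 1 (dist x y) := rfl

lemma ofReal_truncDist {E : Type*} [MetricSpace E] (x y : E) :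
    ENNReal.ofReal (truncDist E (x, y)) = min 1 (edist x y) := by
  rw [truncDist_apply, edist_dist, ENNReal.ofReal_min, ENNReal.ofReal_one]

lemma cauchy_of_trunc {E : Type*} [MetricSpace E] (x : ℕ → E)
    (h : ∑' k, min 1 (edist (x k) (x (k + 1))) ≠ ⊤) : CauchySeq x := by
  have h0 := ENNReal.tendsto_atTop_zero_of_tsum_ne_top h
  obtain ⟨N, hN⟩ := eventually_atTop.1 (h0.eventually_lt_const zero_lt_one)
  rw [← cauchySeq_shift N]
  refine cauchySeq_of_edist_le_of_tsum_ne_top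
    (fun k => min 1 (edist (x (k + N)) (x (k + N + 1)))) ?_ ?_
  · intro k
    have := hN (k + N) (Nat.le_add_left _ _)
    have h1 : edist (x (k + N)) (x (k + N + 1)) < 1 := by
      rcases min_lt_iff.1 this with h | h
      · exact absurd h (lt_irrefl _)
      · exact h
    rw [min_eq_right h1.le]
    have e : k.succ + N = k + N + 1 := by omega
    rw [e]
  · exact ne_top_of_le_ne_top h (ENNReal.tsum_comp_le_tsum_of_injective
      (add_left_injective N) (fun k => min 1 (edist (x k) (x (k + 1)))))

/-- Gyöngy–Krylov criterion: let `(X_n)` be random variables on a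
probability space `(Ω, 𝓕, ℙ)` with values in a complete separable metric space
`(E, d)`.  Assume that for every pair of subsequences `(n₁(k), n₂(k))` with
`n₁(k) ≥ n₂(k)` there is a further subsequence along which the pairs
`(X_{n₁(k(h))}, X_{n₂(k(h))})` converge in distribution to a probability measure
`μ` on `E × E` with `μ(D) = 1`, `D` the diagonal.  Then there is a random variable
`X` with `X_n → X` in probability. -/
theorem statement11
    {Ω : Type*} [MeasurableSpace Ω] (P : Measure Ω) [IsProbabilityMeasure P]
    {E : Type*} [MetricSpace E] [CompleteSpace E] [TopologicalSpace.SeparableSpace E]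
    [MeasurableSpace E] [BorelSpace E]
    (X : ℕ → Ω → E) (hX : ∀ n, Measurable (X n))
    (hyp : ∀ n₁ n₂ : ℕ → ℕ, StrictMono n₁ → StrictMono n₂ → (∀ k, n₂ k ≤ n₁ k) →
      ∃ φ : ℕ → ℕ, StrictMono φ ∧
        ∃ μ : Measure (E × E), IsProbabilityMeasure μ ∧
          μ {p : E × E | p.1 = p.2} = 1 ∧
          -- convergence in distribution: weak convergence of the laws
          ∀ f : BoundedContinuousFunction (E × E) ℝ,
            Tendsto (fun h : ℕ => ∫ ω, f (X (n₁ (φ h)) ω, X (n₂ (φ h)) ω) ∂P)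
              atTop (nhds (∫ p, f p ∂μ))) :
    ∃ Y : Ω → E, Measurable Y ∧
      -- convergence in probability
      ∀ ε : ℝ, 0 < ε →
        Tendsto (fun n : ℕ => P {ω | ε < dist (X n ω) (Y ω)}) atTop (nhds 0) := by
  classical
  haveI : SecondCountableTopology E := UniformSpace.secondCountable_of_separable E
  have hΩ : Nonempty Ω := nonempty_of_isProbabilityMeasure P
  have hE : Nonempty E := hΩ.map (X 0)
  have hmeas : ∀ m n, Measurable (fun ω => min 1 (edist (X m ω) (X n ω))) := fun m n =>
    measurable_const.min ((hX m).edist (hX n))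
  -- the Cauchy property
  have key : ∀ ε : ENNReal, 0 < ε → ∃ N, ∀ m n, N ≤ n → n ≤ m →
      ∫⁻ ω, min 1 (edist (X m ω) (X n ω)) ∂P < ε := by
    intro ε hε
    by_contra hcon
    push Not at hcon
    choose m n hn hnm hle using hcon
    let s : ℕ → ℕ := fun k => Nat.rec 0 (fun _ r => m r + 1) k
    have hs : ∀ k, s (k + 1) = m (s k) + 1 := fun k => rfl
    obtain ⟨φ, hφ, μ, hμ, hD, hconv⟩ := hyp (fun k => m (s k)) (fun k => n (s k))
      (strictMono_nat_of_lt_succ fun k => by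
        have h1 := hn (s (k + 1)); have h2 := hnm (s (k + 1)); have h3 := hs k
        omega)
      (strictMono_nat_of_lt_succ fun k => by
        have h1 := hn (s (k + 1)); have h2 := hnm (s k); have h3 := hs k
        omega)
      (fun k => hnm _)
    have hlim := hconv (truncDist E)
    have hzero : ∫ p, truncDist E p ∂μ = 0 := by
      have hDm : MeasurableSet {p : E × E | p.1 = p.2} :=
        measurableSet_eq_fun measurable_fst measurable_snd
      have hae : ∀ᵐ p ∂μ, p.1 = p.2 := (prob_compl_eq_zero_iff hDm).2 hD
      refine integral_eq_zero_of_ae ?_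
      filter_upwards [hae] with p hp
      obtain ⟨x, y⟩ := p
      have : x = y := hp
      subst this
      simp [truncDist_apply]
    rw [hzero] at hlim
    have hlim2 := ENNReal.tendsto_ofReal hlim
    rw [ENNReal.ofReal_zero] at hlim2
    refine absurd (ge_of_tendsto' hlim2 (fun h => ?_)) (not_le.2 hε)
    have hm1 : Measurable (fun ω => truncDist E (X (m (s (φ h))) ω, X (n (s (φ h))) ω)) :=
      (truncDist E).continuous.measurable.comp ((hX _).prodMk (hX _))
    rw [ofReal_integral_eq_lintegral_ofReal]
    · simp only [ofReal_truncDist]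
      exact hle _
    · refine Integrable.of_bound hm1.aestronglyMeasurable 1 (Eventually.of_forall fun ω => ?_)
      rw [truncDist_apply, Real.norm_of_nonneg (le_min zero_le_one dist_nonneg)]
      exact min_le_left _ _
    · exact Eventually.of_forall fun ω => le_min zero_le_one dist_nonneg
  have key' : ∀ ε : ENNReal, 0 < ε → ∃ N, ∀ m n, N ≤ n → N ≤ m →
      ∫⁻ ω, min 1 (edist (X m ω) (X n ω)) ∂P < ε := by
    intro ε hε
    obtain ⟨N, hN⟩ := key ε hε
    refine ⟨N, fun m n hn hm => ?_⟩
    rcases le_total n m with h | h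
    · exact hN m n hn h
    · have := hN n m hm h
      simpa only [edist_comm] using this
  -- fast subsequence
  obtain ⟨δ, hδ, hδs⟩ := ENNReal.exists_pos_sum_of_countable' (ε := 1) one_ne_zero ℕ
  choose N hN using fun k => key' (δ k) (hδ k)
  obtain ⟨g, hg, hgN⟩ : ∃ g : ℕ → ℕ, StrictMono g ∧ ∀ k, N k ≤ g k := by
    refine ⟨fun k => ∑ i ∈ Finset.range (k + 1), (N i + 1), ?_, fun k => ?_⟩
    · refine strictMono_nat_of_lt_succ fun k => ?_
      rw [Finset.sum_range_succ _ (k + 1)]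
      omega
    · show N k ≤ ∑ i ∈ Finset.range (k + 1), (N i + 1)
      rw [Finset.sum_range_succ]
      omega
  have hae : ∀ᵐ ω ∂P, ∃ l, Tendsto (fun k => X (g k) ω) atTop (nhds l) := by
    have hfin : ∫⁻ ω, ∑' k, min 1 (edist (X (g k) ω) (X (g (k + 1)) ω)) ∂P ≠ ⊤ := by
      rw [lintegral_tsum fun k => (hmeas _ _).aemeasurable]
      refine ne_top_of_le_ne_top (hδs.trans ENNReal.one_lt_top).ne
        (ENNReal.tsum_le_tsum fun k => (hN k _ _ ?_ (hgN k)).le)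
      exact (hgN k).trans (hg (Nat.lt_succ_self k)).le
    filter_upwards [ae_lt_top (Measurable.ennreal_tsum fun k => hmeas _ _) hfin] with ω hω
    exact cauchySeq_tendsto_of_complete (cauchy_of_trunc _ hω.ne)
  obtain ⟨Y, hY, hYlim⟩ := measurable_limit_of_tendsto_metrizable_ae
    (fun k => (hX (g k)).aemeasurable) hae
  refine ⟨Y, hY, fun ε hε => ?_⟩
  have hlim : Tendsto (fun n => ∫⁻ ω, min 1 (edist (X n ω) (Y ω)) ∂P) atTop (nhds 0) := by
    rw [ENNReal.tendsto_atTop_zero]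
    intro η hη
    obtain ⟨K, hK⟩ := key' η hη
    refine ⟨K, fun n hn => ?_⟩
    calc ∫⁻ ω, min 1 (edist (X n ω) (Y ω)) ∂P
        = ∫⁻ ω, liminf (fun k => min 1 (edist (X n ω) (X (g k) ω))) atTop ∂P := by
          refine lintegral_congr_ae ?_
          filter_upwards [hYlim] with ω hω
          exact ((tendsto_const_nhds.min (tendsto_const_nhds.edist hω)).liminf_eq).symm
      _ ≤ liminf (fun k => ∫⁻ ω, min 1 (edist (X n ω) (X (g k) ω)) ∂P) atTop :=
          lintegral_liminf_le fun k => hmeas _ _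
      _ ≤ η := by
          refine liminf_le_of_frequently_le' (Eventually.frequently ?_)
          filter_upwards [eventually_ge_atTop K] with k hk
          exact (hK n (g k) (hk.trans hg.le_apply) hn).le
  set c : ENNReal := min 1 (ENNReal.ofReal ε) with hc
  have hc0 : c ≠ 0 := (lt_min zero_lt_one (ENNReal.ofReal_pos.2 hε)).ne'
  have hct : c ≠ ⊤ := ne_top_of_le_ne_top ENNReal.one_ne_top (min_le_left _ _)
  have hdiv : Tendsto (fun n => (∫⁻ ω, min 1 (edist (X n ω) (Y ω)) ∂P) / c) atTop (nhds 0) := by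
    simpa using ENNReal.Tendsto.div_const hlim (Or.inr hc0)
  refine tendsto_of_tendsto_of_tendsto_of_le_of_le tendsto_const_nhds hdiv
    (fun n => zero_le) (fun n => ?_)
  refine (measure_mono fun ω hω => ?_).trans (meas_ge_le_lintegral_div
    (measurable_const.min ((hX n).edist hY)).aemeasurable hc0 hct)
  have hω' : ε < dist (X n ω) (Y ω) := hω
  show c ≤ min 1 (edist (X n ω) (Y ω))
  rw [edist_dist]
  exact min_le_min le_rfl (ENNReal.ofReal_le_ofReal hω'.le)

end PaperProb
end
end

section
/- (Exponential law of large numbers) There exists a universal constant Ĉ > 0 with the following property. Let d, N ∈ ℕ, let μ ∈ L^1(𝕋^d) with μ ≥ 0 and ∫_{𝕋^d} μ dx = 1, and let φ ∈ L^∞(𝕋^d × 𝕋^d) satisfy γ := Ĉ ‖φ‖_{L^∞(𝕋^d × 𝕋^d)} < 1 together with the cancellations ∫_{𝕋^d} φ(x,z) μ(x) dx = 0 for all z ∈ 𝕋^d and ∫_{𝕋^d} φ(x,z) μ(z) dz = 0 for all x ∈ 𝕋^d. Then ∫_{𝕋^{dN}} μ^{⊗N}(x₁,…,x_N) exp( |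 (1/N) Σ_{i,j=1}^N φ(x_i, x_j) | ) dx₁ ⋯ dx_N ≤ 2/(1−γ) < ∞. -/
open MeasureTheory
open scoped BigOperators

noncomputable section
namespace PaperTorus

lemma integrable_of_bdd {α : Type*} [MeasurableSpace α] (ν : Measure α) [IsFiniteMeasure ν]
    {f : α → ℝ} (hf : Measurable f) (C : ℝ) (hC : ∀ x, |f x| ≤ C) : Integrable f ν :=
  Integrable.of_bound hf.aestronglyMeasurable C (Filter.Eventually.of_forall hC)

lemma gauss_mgf (a : ℝ) :
    ∫ g, Real.exp (a * g) ∂(ProbabilityTheory.gaussianReal 0 1) = Real.exp (a ^ 2 / 2) := by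
  have := ProbabilityTheory.mgf_gaussianReal (p := ProbabilityTheory.gaussianReal 0 1)
    (X := id) (μ := 0) (v := 1) (by simp) a
  simpa [ProbabilityTheory.mgf] using this

lemma gauss_sq (q : ℝ) (hq : 2 * q < 1) :
    Integrable (fun g : ℝ => Real.exp (q * g ^ 2)) (ProbabilityTheory.gaussianReal 0 1) ∧
    ∫ g, Real.exp (q * g ^ 2) ∂(ProbabilityTheory.gaussianReal 0 1) = 1 / √(1 - 2 * q) := by
  have key : ∀ g : ℝ, ProbabilityTheory.gaussianPDFReal 0 1 g • Real.exp (q * g ^ 2)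
      = (√(2 * Real.pi))⁻¹ * Real.exp (-(1 / 2 - q) * g ^ 2) := by
    intro g
    simp only [ProbabilityTheory.gaussianPDFReal, smul_eq_mul, NNReal.coe_one, mul_one]
    rw [mul_assoc, ← Real.exp_add]
    congr 2
    ring
  constructor
  · rw [ProbabilityTheory.gaussianReal_of_var_ne_zero _ one_ne_zero,
      integrable_withDensity_iff_integrable_smul' (ProbabilityTheory.measurable_gaussianPDF _ _)
      (ae_of_all _ fun _ ↦ ProbabilityTheory.gaussianPDF_lt_top)]
    simp only [ProbabilityTheory.toReal_gaussianPDF, key]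
    exact (integrable_exp_neg_mul_sq (by linarith)).const_mul _
  · rw [ProbabilityTheory.integral_gaussianReal_eq_integral_smul one_ne_zero]
    simp only [key]
    rw [integral_const_mul, integral_gaussian, ← Real.sqrt_inv, ← Real.sqrt_mul (by positivity),
      one_div (√(1 - 2 * q)), ← Real.sqrt_inv]
    congr 1
    have : (1 - 2 * q) ≠ 0 := by linarith
    have h2 : (1 / 2 - q) ≠ 0 := by intro h; apply this; linarith
    have := Real.pi_ne_zero
    field_simp
    

lemma hoeff {α : Type*} [MeasurableSpace α] (ν : Measure α) [IsProbabilityMeasure ν]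
    {f : α → ℝ} (hf : Measurable f) (B : ℝ) (hB : ∀ x, |f x| ≤ B) (h0 : ∫ x, f x ∂ν = 0) (t : ℝ) :
    ∫ x, Real.exp (t * f x) ∂ν ≤ Real.exp (B ^ 2 * t ^ 2 / 2) := by
  have := (ProbabilityTheory.hasSubgaussianMGF_of_mem_Icc_of_integral_eq_zero (μ := ν) (X := f)
    (a := -B) (b := B) hf.aemeasurable
    (ae_of_all _ fun x => ⟨(abs_le.1 (hB x)).1, (abs_le.1 (hB x)).2⟩) h0).mgf_le t
  refine this.trans_eq ?_
  congr 1
  have e : ((((‖B - -B‖₊ / 2) ^ 2 : NNReal)) : ℝ) = B ^ 2 := by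
    push_cast
    rw [Real.norm_eq_abs, div_pow, sq_abs]
    ring
  rw [e]

lemma subG {α ι : Type*} [Fintype ι] [MeasurableSpace α] (ν : Measure α) [IsProbabilityMeasure ν]
    {f : α → ℝ} (hf : Measurable f) (B : ℝ) (hB : ∀ x, |f x| ≤ B) (h0 : ∫ x, f x ∂ν = 0)
    (s q : ℝ) (hs : 0 ≤ s) (hq : Fintype.card ι * (s * B ^ 2) ≤ q) (hq1 : 2 * q < 1) :
    ∫ y : ι → α, Real.exp (s * (∑ i, f (y i)) ^ 2) ∂(Measure.pi fun _ => ν)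
      ≤ 1 / √(1 - 2 * q) := by
  set G := ProbabilityTheory.gaussianReal 0 1
  set a := √(2 * s)
  have ha : a ^ 2 = 2 * s := Real.sq_sqrt (by linarith)
  have ha0 : 0 ≤ a := Real.sqrt_nonneg _
  set K := a * (Fintype.card ι * B)
  have hS : ∀ y : ι → α, |a * ∑ i, f (y i)| ≤ K := by
    intro y
    rw [abs_mul, abs_of_nonneg ha0]
    refine mul_le_mul_of_nonneg_left ?_ ha0
    calc _ ≤ ∑ i, |f (y i)| := Finset.abs_sum_le_sum_abs _ _
      _ ≤ ∑ i : ι, B := Finset.sum_le_sum fun i _ => hB _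
      _ = _ := by simp
  have hI : Integrable (fun p : (ι → α) × ℝ => Real.exp (a * (∑ i, f (p.1 i)) * p.2))
      ((Measure.pi fun _ => ν).prod G) := by
    have h1 : Integrable (fun p : (ι → α) × ℝ => Real.exp (K * p.2) + Real.exp (-K * p.2))
      ((Measure.pi fun _ : ι => ν).prod G) :=
      ((ProbabilityTheory.integrable_exp_mul_gaussianReal K).add
        (ProbabilityTheory.integrable_exp_mul_gaussianReal (-K))).comp_snd _
    refine h1.mono' ?_ (ae_of_all _ ?_)
    · apply Measurable.aestronglyMeasurable
      fun_prop
    · rintro ⟨y, g⟩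
      have h2 := hS y
      dsimp only
      rw [Real.norm_eq_abs, Real.abs_exp]
      have h3 : a * (∑ i, f (y i)) * g ≤ |K * g| := by
        refine (le_abs_self _).trans ?_
        rw [abs_mul, abs_mul K]
        exact mul_le_mul_of_nonneg_right (h2.trans (le_abs_self _)) (abs_nonneg _)
      refine (Real.exp_le_exp.2 h3).trans ?_
      rw [neg_mul]
      exact Real.exp_abs_le _
  calc _ = ∫ y : ι → α, (∫ g, Real.exp (a * (∑ i, f (y i)) * g) ∂G) ∂(Measure.pi fun _ => ν) := by
        congr with y
        rw [gauss_mgf, mul_pow, ha]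
        congr 1; ring
    _ = ∫ g, (∫ y : ι → α, Real.exp (a * (∑ i, f (y i)) * g) ∂(Measure.pi fun _ => ν)) ∂G :=
        integral_integral_swap hI
    _ ≤ ∫ g, Real.exp (q * g ^ 2) ∂G := by
        refine integral_mono hI.integral_prod_right (gauss_sq q hq1).1 fun g => ?_
        have e : ∀ y : ι → α, Real.exp (a * (∑ i, f (y i)) * g) =
            ∏ i, Real.exp ((a * g) * f (y i)) := by
          intro y
          rw [← Real.exp_sum, ← Finset.mul_sum]
          congr 1; ring
        simp only [e]
        rw [integral_fintype_prod_eq_pow (fun x => Real.exp ((a * g) * f x))]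
        calc _ ≤ (Real.exp (B ^ 2 * (a * g) ^ 2 / 2)) ^ (Fintype.card ι) := by
              refine pow_le_pow_left₀ ?_ (hoeff ν hf B hB h0 _) _
              exact integral_nonneg fun x => (Real.exp_pos _).le
          _ = Real.exp (Fintype.card ι * (s * B ^ 2) * g ^ 2) := by
              rw [← Real.exp_nat_mul, mul_pow, ha]
              congr 1; ring
          _ ≤ _ := by gcongr
    _ = _ := (gauss_sq q hq1).2

lemma jensen_step {α : Type*} [MeasurableSpace α] (ν : Measure α) [IsProbabilityMeasure ν]
    {h : α → ℝ} (hf : Measurable h) (hB : ∀ x, |h x| ≤ 1) (h0 : ∫ x, h x ∂ν = 0) (m : ℕ) :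
    (∫ x, Real.exp (h x) ∂ν) ^ m ≤ ∫ x, Real.exp (m * h x ^ 2) ∂ν := by
  have hsq : ∀ x, h x ^ 2 ≤ 1 := fun x => by
    rw [← sq_abs]; have := hB x; have := abs_nonneg (h x); nlinarith
  have i1 : Integrable h ν := integrable_of_bdd ν hf 1 hB
  have i2 : Integrable (fun x => h x ^ 2) ν := integrable_of_bdd ν (by fun_prop) 1
    (fun x => by rw [abs_of_nonneg (sq_nonneg _)]; exact hsq x)
  have i3 : Integrable (fun x => Real.exp (h x)) ν := integrable_of_bdd ν (by fun_prop) (Real.exp 1)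
    (fun x => by rw [Real.abs_exp]; exact Real.exp_le_exp.2 ((le_abs_self _).trans (hB x)))
  have i4 : Integrable (fun x => Real.exp (m * h x ^ 2)) ν :=
    integrable_of_bdd ν (by fun_prop) (Real.exp (m * 1))
    (fun x => by rw [Real.abs_exp]; have := hsq x; gcongr)
  have s1 : ∫ x, Real.exp (h x) ∂ν ≤ Real.exp (∫ x, h x ^ 2 ∂ν) := by
    calc _ ≤ ∫ x, ((1 + h x) + h x ^ 2) ∂ν := by
          refine integral_mono i3 (((integrable_const _).add i1).add i2) fun x => ?_
          have := (abs_le.1 (Real.abs_exp_sub_one_sub_id_le (hB x))).2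
          dsimp only
          linarith
      _ = 1 + ∫ x, h x ^ 2 ∂ν := by
          have i5 : Integrable (fun x => 1 + h x) ν := (integrable_const _).add i1
          rw [integral_add i5 i2, integral_add (integrable_const _) i1, h0]
          simp
      _ ≤ _ := by rw [add_comm]; exact Real.add_one_le_exp _
  calc _ ≤ Real.exp (∫ x, h x ^ 2 ∂ν) ^ m := by
        refine pow_le_pow_left₀ ?_ s1 _
        exact integral_nonneg fun x => (Real.exp_pos _).le
    _ = Real.exp (∫ x, m * h x ^ 2 ∂ν) := by rw [← Real.exp_nat_mul, integral_const_mul]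
    _ ≤ _ := convexOn_exp.map_integral_le Real.continuous_exp.continuousOn isClosed_univ
        (by simp) (i2.const_mul _) i4

lemma decoupled {α ι κ : Type*} [Fintype ι] [Fintype κ] [MeasurableSpace α] (ν : Measure α)
    [IsProbabilityMeasure ν] (N : ℕ) (hN : 1 ≤ N) (hι : Fintype.card ι ≤ N)
    (hκ : Fintype.card κ ≤ N) (φ : α → α → ℝ) (hφ : Measurable (Function.uncurry φ))
    (B : ℝ) (hB : ∀ x z, |φ x z| ≤ B) (hB8 : 8 * B < 1)
    (h1 : ∀ z, ∫ x, φ x z ∂ν = 0) (h2 : ∀ x, ∫ z, φ x z ∂ν = 0) :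
    ∫ y : ι → α, (∫ w : κ → α, Real.exp (4 / N * ∑ i, ∑ j, φ (y i) (w j)) ∂(Measure.pi fun _ => ν))
      ∂(Measure.pi fun _ => ν) ≤ 1 / √(1 - 32 * B ^ 2) := by
  have hN0 : (0 : ℝ) < N := by exact_mod_cast hN
  have hα : Nonempty α := by
    by_contra hc
    rw [not_nonempty_iff] at hc
    exact IsProbabilityMeasure.ne_zero ν (Measure.eq_zero_of_isEmpty ν)
  obtain ⟨x0⟩ := hα
  have hB0 : 0 ≤ B := (abs_nonneg _).trans (hB x0 x0)
  have hm : ∀ (β : Type _) [MeasurableSpace β] (u v : β → α), Measurable u → Measurable v →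
    Measurable fun b => φ (u b) (v b) := fun β _ u v hu hv => hφ.comp (hu.prodMk hv)
  have hm2 : Measurable fun p : (ι → α) × α => ∑ i, φ (p.1 i) p.2 :=
    Finset.measurable_sum _ fun i _ => hφ.comp (f := fun p : (ι → α) × α => (p.1 i, p.2))
      (by fun_prop)
  have hSb : ∀ (y : ι → α) z, |∑ i, φ (y i) z| ≤ N * B := by
    intro y z
    calc _ ≤ ∑ i, |φ (y i) z| := Finset.abs_sum_le_sum_abs _ _
      _ ≤ ∑ i : ι, B := Finset.sum_le_sum fun i _ => hB _ _
      _ = Fintype.card ι * B := by simp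
      _ ≤ _ := by gcongr
  have hIntg : Integrable (fun p : (ι → α) × α => Real.exp (16 / N * (∑ i, φ (p.1 i) p.2) ^ 2))
      ((Measure.pi fun _ => ν).prod ν) := by
    refine integrable_of_bdd _ (by fun_prop) (Real.exp (16 / N * (N * B) ^ 2)) fun p => ?_
    rw [Real.abs_exp]
    have := hSb p.1 p.2
    rw [← sq_abs (∑ i, φ (p.1 i) p.2)]
    gcongr
  have step : ∀ y : ι → α,
      ∫ w : κ → α, Real.exp (4 / N * ∑ i, ∑ j, φ (y i) (w j)) ∂(Measure.pi fun _ => ν)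
      ≤ ∫ z, Real.exp (16 / N * (∑ i, φ (y i) z) ^ 2) ∂ν := by
    intro y
    have hmy : Measurable fun z => ∑ i, φ (y i) z := hm2.comp (measurable_prodMk_left (x := y))
    have e : ∀ w : κ → α, Real.exp (4 / N * ∑ i, ∑ j, φ (y i) (w j)) =
        ∏ j, Real.exp (4 / N * ∑ i, φ (y i) (w j)) := by
      intro w
      rw [← Real.exp_sum, ← Finset.mul_sum, Finset.sum_comm]
    simp only [e]
    rw [integral_fintype_prod_eq_pow (fun z => Real.exp (4 / N * ∑ i, φ (y i) z))]
    refine (jensen_step ν (hmy.const_mul _) ?_ ?_ _).trans ?_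
    · intro z
      rw [abs_mul, abs_of_nonneg (by positivity)]
      calc _ ≤ 4 / N * (N * B) := by gcongr; exact hSb y z
        _ = 4 * B := by field_simp
        _ ≤ 1 := by linarith
    · rw [integral_const_mul, integral_finsetSum]
      · simp [h2]
      · intro i _
        exact integrable_of_bdd ν (hφ.comp (measurable_prodMk_left (x := y i))) B fun z => hB _ _
    · refine integral_mono (integrable_of_bdd _ (by fun_prop)
        (Real.exp (N * (4 / N * (N * B)) ^ 2)) fun z => ?_) 
        (integrable_of_bdd _ (by fun_prop) (Real.exp (16 / N * (N * B) ^ 2)) fun z => ?_) fun z => ?_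
      · rw [Real.abs_exp, mul_pow, mul_pow, ← sq_abs (∑ i, φ (y i) z)]
        have := hSb y z
        gcongr
      · rw [Real.abs_exp, ← sq_abs (∑ i, φ (y i) z)]
        have := hSb y z
        gcongr
      · dsimp only
        apply Real.exp_le_exp.2
        calc _ ≤ (N : ℝ) * (4 / N * ∑ i, φ (y i) z) ^ 2 := by gcongr
          _ = _ := by field_simp; ring
  calc _ ≤ ∫ y : ι → α, (∫ z, Real.exp (16 / N * (∑ i, φ (y i) z) ^ 2) ∂ν)
      ∂(Measure.pi fun _ => ν) :=
        integral_mono_of_nonneg (ae_of_all _ fun y => integral_nonneg fun w => (Real.exp_pos _).le)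
          hIntg.integral_prod_left (ae_of_all _ step)
    _ = ∫ z, (∫ y : ι → α, Real.exp (16 / N * (∑ i, φ (y i) z) ^ 2) ∂(Measure.pi fun _ => ν)) ∂ν :=
        integral_integral_swap hIntg
    _ ≤ ∫ z, 1 / √(1 - 32 * B ^ 2) ∂ν := by
        refine integral_mono hIntg.integral_prod_right (integrable_const _) fun z => ?_
        have := subG (ι := ι) ν (f := fun x => φ x z) (hφ.comp (measurable_prodMk_right (y := z))) B
          (fun x => hB _ _) (h1 z) (16 / N) (16 * B ^ 2) (by positivity) ?_ (by nlinarith)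
        · rw [show (1 : ℝ) - 32 * B ^ 2 = 1 - 2 * (16 * B ^ 2) by ring]
          exact this
        · calc _ ≤ (N : ℝ) * (16 / N * B ^ 2) := by gcongr
            _ = _ := by field_simp
    _ = _ := by simp

lemma avg_id (N : ℕ) (a : Fin N → Fin N → ℝ) :
    ∑ i, ∑ j, a i j = ∑ i, a i i + ∑ I : Finset (Fin N), (1 / 2 ^ N : ℝ) *
      (4 * ∑ i : {i // i ∈ I}, ∑ j : {j // ¬ j ∈ I}, a i j) := by
  have e1 : ∀ I : Finset (Fin N), ∑ i : {i // i ∈ I}, ∑ j : {j // ¬ j ∈ I}, a i j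
      = ∑ i, ∑ j, if i ∈ I ∧ j ∉ I then a i j else 0 := by
    intro I
    have : ∀ f : Fin N → ℝ, ∑ j : {j // ¬ j ∈ I}, f j = ∑ j, if j ∉ I then f j else 0 := by
      intro f
      rw [← Finset.sum_filter]
      exact (Finset.sum_subtype _ (by simp) f).symm
    simp only [this]
    have : ∀ f : Fin N → ℝ, ∑ j : {j // j ∈ I}, f j = ∑ j, if j ∈ I then f j else 0 := by
      intro f
      rw [← Finset.sum_filter]
      exact (Finset.sum_subtype _ (by simp) f).symm
    rw [this (fun i => ∑ j, if j ∉ I then a i j else 0)]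
    refine Finset.sum_congr rfl fun i _ => ?_
    by_cases h : i ∈ I <;> simp [h]
  have e2 : ∀ i j : Fin N, ∑ I : Finset (Fin N), (1 / 2 ^ N : ℝ) * (4 *
      if i ∈ I ∧ j ∉ I then a i j else 0) = if i = j then 0 else a i j := by
    intro i j
    rw [← Finset.mul_sum, ← Finset.mul_sum, ← Finset.sum_filter, Finset.sum_const]
    split_ifs with h
    · subst h
      rw [Finset.filter_false_of_mem (by simp)]; simp
    · have : (Finset.univ.filter fun I : Finset (Fin N) => i ∈ I ∧ j ∉ I)
          = Finset.Icc {i} (Finset.univ.erase j) := by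
        ext I
        simp [Finset.subset_erase]
      rw [this, Finset.card_Icc_finset (by simpa using h)]
      have hN : 2 ≤ N := by have := i.2; have := j.2; have : i.1 ≠ j.1 := fun h' => h (Fin.ext h'); omega
      obtain ⟨M, rfl⟩ := Nat.exists_eq_add_of_le hN
      simp only [Finset.card_erase_of_mem (Finset.mem_univ _), Finset.card_univ, Fintype.card_fin,
        Finset.card_singleton]
      have : 2 + M - 1 - 1 = M := by omega
      rw [this, pow_add]
      simp
      field_simp
      norm_num
  simp only [e1, Finset.mul_sum]
  rw [Finset.sum_comm (s := (Finset.univ : Finset (Finset (Fin N)))), ← Finset.sum_add_distrib]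
  refine Finset.sum_congr rfl fun i _ => ?_
  rw [Finset.sum_comm (s := (Finset.univ : Finset (Finset (Fin N))))]
  simp only [e2]
  rw [← Finset.add_sum_erase _ _ (Finset.mem_univ i), ← Finset.add_sum_erase _ (fun j => if i = j then 0 else a i j) (Finset.mem_univ i)]
  simp only [if_true, zero_add]
  congr 1
  refine Finset.sum_congr rfl fun j hj => ?_
  rw [if_neg]
  exact fun h => (Finset.mem_erase.1 hj).1 h.symm

lemma one_sided {α : Type*} [MeasurableSpace α] (ν : Measure α)
    [IsProbabilityMeasure ν] (N : ℕ) (hN : 1 ≤ N) (φ : α → α → ℝ)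
    (hφ : Measurable (Function.uncurry φ))
    (B : ℝ) (hB0 : 0 ≤ B) (hB : ∀ x z, |φ x z| ≤ B) (hB8 : 8 * B < 1)
    (h1 : ∀ z, ∫ x, φ x z ∂ν = 0) (h2 : ∀ x, ∫ z, φ x z ∂ν = 0) :
    ∫ X : Fin N → α, Real.exp (1 / N * ∑ i, ∑ j, φ (X i) (X j)) ∂(Measure.pi fun _ => ν)
      ≤ 1 / (1 - 8 * B) := by
  have hN0 : (0 : ℝ) < N := by exact_mod_cast hN
  have hmm : ∀ i j, Measurable fun X : Fin N → α => φ (X i) (X j) := fun i j =>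
    hφ.comp (f := fun X : Fin N → α => (X i, X j)) (by fun_prop)
  let T : Finset (Fin N) → (Fin N → α) → ℝ := fun I X =>
    4 / N * ∑ i : {i // i ∈ I}, ∑ j : {j // ¬ j ∈ I}, φ (X i) (X j)
  have hTm : ∀ I, Measurable (T I) := fun I => by
    refine Measurable.const_mul ?_ _
    exact Finset.measurable_sum _ fun i _ => Finset.measurable_sum _ fun j _ => hmm _ _
  have hTb : ∀ I X, T I X ≤ 4 / N * (N * (N * B)) := by
    intro I X
    dsimp only [T]
    gcongr
    calc _ ≤ ∑ i : {i // i ∈ I}, ∑ j : {j // ¬ j ∈ I}, B :=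
          Finset.sum_le_sum fun i _ => Finset.sum_le_sum fun j _ => (le_abs_self _).trans (hB _ _)
      _ = (Fintype.card {i // i ∈ I} : ℝ) * (Fintype.card {j // ¬ j ∈ I} * B) := by
          simp only [Finset.sum_const, Finset.card_univ, nsmul_eq_mul]
      _ ≤ _ := by
          have a1 := Fintype.card_subtype_le (fun i => i ∈ I)
          have a2 := Fintype.card_subtype_le (fun i => ¬ i ∈ I)
          rw [Fintype.card_fin] at a1 a2
          gcongr
  have hTi : ∀ I, Integrable (fun X => Real.exp (T I X)) (Measure.pi fun _ : Fin N => ν) :=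
    fun I => integrable_of_bdd _ (hTm I).exp (Real.exp (4 / N * (N * (N * B)))) fun X => by
      rw [Real.abs_exp]; exact Real.exp_le_exp.2 (hTb I X)
  have hT : ∀ I, ∫ X, Real.exp (T I X) ∂(Measure.pi fun _ : Fin N => ν)
      ≤ 1 / √(1 - 32 * B ^ 2) := by
    intro I
    have a1 := Fintype.card_subtype_le (fun i => i ∈ I)
    have a2 := Fintype.card_subtype_le (fun i => ¬ i ∈ I)
    rw [Fintype.card_fin] at a1 a2
    have mp : MeasurePreserving (MeasurableEquiv.piEquivPiSubtypeProd (fun _ => α) (fun i => i ∈ I))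
        (Measure.pi fun _ : Fin N => ν) ((Measure.pi fun _ : {i // i ∈ I} => ν).prod
          (Measure.pi fun _ : {j // ¬ j ∈ I} => ν)) := by
      convert measurePreserving_piEquivPiSubtypeProd (fun _ : Fin N => ν) (fun i => i ∈ I)
    let F : ({i // i ∈ I} → α) × ({j // ¬ j ∈ I} → α) → ℝ := fun p =>
      Real.exp (4 / N * ∑ i, ∑ j, φ (p.1 i) (p.2 j))
    have e : (fun X => Real.exp (T I X)) = fun X =>
      F (MeasurableEquiv.piEquivPiSubtypeProd (fun _ => α) (fun i => i ∈ I) X) := rfl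
    have hF : Integrable F ((Measure.pi fun _ => ν).prod (Measure.pi fun _ => ν)) := by
      rw [← mp.integrable_comp_emb (MeasurableEquiv.measurableEmbedding _)]
      exact hTi I
    rw [e, mp.integral_comp', integral_prod _ hF]
    exact decoupled ν N hN a1 a2 φ hφ B hB hB8 h1 h2
  have pw : ∀ X : Fin N → α, Real.exp (1 / N * ∑ i, ∑ j, φ (X i) (X j)) ≤
      Real.exp B * ∑ I : Finset (Fin N), (1 / 2 ^ N : ℝ) * Real.exp (T I X) := by
    intro X
    have e : 1 / N * ∑ i, ∑ j, φ (X i) (X j) = 1 / N * ∑ i, φ (X i) (X i) +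
        ∑ I : Finset (Fin N), (1 / 2 ^ N : ℝ) • T I X := by
      rw [avg_id, mul_add, Finset.mul_sum (Finset.univ : Finset (Finset (Fin N)))]
      congr 1
      refine Finset.sum_congr rfl fun I _ => ?_
      simp only [T, smul_eq_mul]
      ring
    rw [e, Real.exp_add]
    gcongr
    · calc _ ≤ 1 / (N : ℝ) * ∑ i : Fin N, B := by
            gcongr
            exact (le_abs_self _).trans (hB _ _)
        _ = B := by simp; field_simp
    · refine (convexOn_exp.map_sum_le (fun _ _ => by positivity) ?_ (fun _ _ => Set.mem_univ _))
      simp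
  calc _ ≤ ∫ X : Fin N → α, Real.exp B * ∑ I : Finset (Fin N), (1 / 2 ^ N : ℝ) * Real.exp (T I X)
          ∂(Measure.pi fun _ => ν) :=
        integral_mono_of_nonneg (ae_of_all _ fun y => (Real.exp_pos _).le)
          ((integrable_finsetSum _ fun I _ => (hTi I).const_mul _).const_mul _) (ae_of_all _ pw)
    _ = Real.exp B * ∑ I : Finset (Fin N), (1 / 2 ^ N : ℝ) *
          ∫ X, Real.exp (T I X) ∂(Measure.pi fun _ => ν) := by
        rw [integral_const_mul, integral_finsetSum _ fun I _ => (hTi I).const_mul _]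
        simp only [integral_const_mul]
    _ ≤ Real.exp B * ∑ I : Finset (Fin N), (1 / 2 ^ N : ℝ) * (1 / √(1 - 32 * B ^ 2)) := by
        gcongr with I
        exact hT I
    _ = Real.exp B * (1 / √(1 - 32 * B ^ 2)) := by
        rw [← Finset.sum_mul]; simp
    _ ≤ (1 / (1 - B)) * (1 / (1 - 6 * B)) := by
        have b1 : Real.exp B ≤ 1 / (1 - B) := by
          have := Real.add_one_le_exp (-B)
          rw [Real.exp_neg] at this
          rw [le_div_iff₀ (by linarith)]
          have h := Real.exp_pos B
          calc Real.exp B * (1 - B) ≤ Real.exp B * (Real.exp B)⁻¹ := by gcongr; linarith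
            _ = 1 := mul_inv_cancel₀ h.ne'
        have b2 : 1 - 6 * B ≤ √(1 - 32 * B ^ 2) := Real.le_sqrt_of_sq_le (by nlinarith)
        have b3 : 0 < 1 - 6 * B := by linarith
        have b4 : 0 < 1 - B := by linarith
        gcongr
    _ ≤ _ := by
        have b3 : 0 < 1 - 6 * B := by linarith
        have b4 : 0 < 1 - B := by linarith
        rw [div_mul_div_comm, one_mul]
        refine one_div_le_one_div_of_le (by linarith) ?_
        nlinarith

lemma pi_density {α : Type*} [MeasurableSpace α] (m : Measure α) [SigmaFinite m] (N : ℕ)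
    (f : α → ℝ) (h0 : ∀ x, 0 ≤ f x) (hi : Integrable f m)
    [IsProbabilityMeasure (m.withDensity fun x => ENNReal.ofReal (f x))] :
    (Measure.pi fun _ : Fin N => m.withDensity fun x => ENNReal.ofReal (f x)) =
      (Measure.pi fun _ : Fin N => m).withDensity fun X => ENNReal.ofReal (∏ i, f (X i)) := by
  refine Measure.pi_eq fun s hs => ?_
  rw [withDensity_apply _ (MeasurableSet.univ_pi hs), Measure.restrict_pi_pi,
    ← ofReal_integral_eq_lintegral_ofReal]
  · rw [integral_fintype_prod_eq_prod (fun _ => f),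
      ENNReal.ofReal_prod_of_nonneg fun i _ => integral_nonneg h0]
    refine Finset.prod_congr rfl fun i _ => ?_
    rw [withDensity_apply _ (hs i), ofReal_integral_eq_lintegral_ofReal hi.restrict (ae_of_all _ h0)]
  · exact Integrable.fintype_prod (f := fun _ => f) fun i => hi.restrict
  · exact ae_of_all _ fun X => Finset.prod_nonneg fun i _ => h0 _

lemma main_bound (d N : ℕ) (hN : 1 ≤ N)
      (μ : (Fin d → ℝ) → ℝ)
        (hμ : Measurable μ) (hμ0 : ∀ x, 0 ≤ μ x)
        (hμi : IntegrableOn μ (box d)) (hμ1 : (∫ x in box d, μ x) = 1)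
      (φ : (Fin d → ℝ) → (Fin d → ℝ) → ℝ)
        (hφ : Measurable (Function.uncurry φ))
      (B : ℝ) (hB : ∀ x z, |φ x z| ≤ B) (hB8 : 8 * B < 1)
        (h1 : ∀ z, (∫ x in box d, φ x z * μ x) = 0)
        (h2 : ∀ x, (∫ z in box d, φ x z * μ z) = 0) :
        (∫ X in (Set.univ.pi fun _ : Fin N => box d),
            (∏ i, μ (X i)) *
              Real.exp |(1 / (N : ℝ)) * ∑ i : Fin N, ∑ j : Fin N, φ (X i) (X j)|)
          ≤ 2 / (1 - 8 * B) := by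
  have hN0 : (0 : ℝ) < N := by exact_mod_cast hN
  have hB0 : 0 ≤ B := (abs_nonneg _).trans (hB 0 0)
  set m : Measure (Fin d → ℝ) := volume.restrict (box d)
  set ν := m.withDensity fun x => ENNReal.ofReal (μ x)
  have hν : IsProbabilityMeasure ν := by
    constructor
    rw [withDensity_apply _ MeasurableSet.univ, Measure.restrict_univ,
      ← ofReal_integral_eq_lintegral_ofReal hμi (ae_of_all _ hμ0), hμ1]
    simp
  have hIntg : ∀ g : (Fin d → ℝ) → ℝ, ∫ x, g x ∂ν = ∫ x in box d, g x * μ x := by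
    intro g
    rw [integral_withDensity_eq_integral_toReal_smul (by fun_prop) (by simp)]
    simp [ENNReal.toReal_ofReal (hμ0 _), mul_comm, m]
  have h1' : ∀ z, ∫ x, φ x z ∂ν = 0 := fun z => by rw [hIntg, h1]
  have h2' : ∀ z, ∫ x, φ z x ∂ν = 0 := fun z => by rw [hIntg, h2]
  rw [volume_pi, Measure.restrict_pi_pi]
  have key : (∫ X, (∏ i, μ (X i)) *
      Real.exp |(1 / (N : ℝ)) * ∑ i : Fin N, ∑ j : Fin N, φ (X i) (X j)| ∂(Measure.pi fun _ => m))
      = ∫ X, Real.exp |(1 / (N : ℝ)) * ∑ i : Fin N, ∑ j : Fin N, φ (X i) (X j)|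
        ∂(Measure.pi fun _ : Fin N => ν) := by
    have := pi_density m N μ hμ0 hμi
    rw [this, integral_withDensity_eq_integral_toReal_smul (by fun_prop) (by simp)]
    simp only [ENNReal.toReal_ofReal (Finset.prod_nonneg fun i _ => hμ0 _), smul_eq_mul]
  rw [key]
  have hmm : ∀ i j, Measurable fun X : Fin N → (Fin d → ℝ) => φ (X i) (X j) := fun i j =>
    hφ.comp (f := fun X : Fin N → (Fin d → ℝ) => (X i, X j)) (by fun_prop)
  have hSm : Measurable fun X : Fin N → (Fin d → ℝ) => 1 / (N : ℝ) * ∑ i, ∑ j, φ (X i) (X j) :=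
    Measurable.const_mul
      (Finset.measurable_sum _ fun i _ => Finset.measurable_sum _ fun j _ => hmm _ _) _
  have hSb : ∀ X : Fin N → (Fin d → ℝ), |1 / (N : ℝ) * ∑ i, ∑ j, φ (X i) (X j)| ≤ N * B := by
    intro X
    rw [abs_mul, abs_of_nonneg (by positivity)]
    calc _ ≤ 1 / (N : ℝ) * ∑ i : Fin N, ∑ j : Fin N, B := by
          gcongr
          refine (Finset.abs_sum_le_sum_abs _ _).trans (Finset.sum_le_sum fun i _ => ?_)
          exact (Finset.abs_sum_le_sum_abs _ _).trans (Finset.sum_le_sum fun i _ => hB _ _)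
      _ = _ := by simp; field_simp
  have iP : Integrable (fun X : Fin N → (Fin d → ℝ) =>
      Real.exp (1 / (N : ℝ) * ∑ i, ∑ j, φ (X i) (X j))) (Measure.pi fun _ : Fin N => ν) :=
    integrable_of_bdd _ hSm.exp (Real.exp (N * B)) fun X => by
      rw [Real.abs_exp]; exact Real.exp_le_exp.2 ((le_abs_self _).trans (hSb X))
  have iM : Integrable (fun X : Fin N → (Fin d → ℝ) =>
      Real.exp (-(1 / (N : ℝ) * ∑ i, ∑ j, φ (X i) (X j)))) (Measure.pi fun _ : Fin N => ν) :=
    integrable_of_bdd _ hSm.neg.exp (Real.exp (N * B)) fun X => by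
      rw [Real.abs_exp]; exact Real.exp_le_exp.2 ((neg_le_abs _).trans (hSb X))
  have rP := one_sided ν N hN φ hφ B hB0 hB hB8 h1' h2'
  have rM := one_sided ν N hN (fun x z => - φ x z) hφ.neg B hB0 (by simpa using hB) hB8
    (fun z => by rw [integral_neg, h1', neg_zero]) (fun z => by rw [integral_neg, h2', neg_zero])
  simp only [Finset.sum_neg_distrib, mul_neg] at rM
  calc _ ≤ ∫ X : Fin N → (Fin d → ℝ), (Real.exp (1 / (N : ℝ) * ∑ i, ∑ j, φ (X i) (X j)) +
        Real.exp (-(1 / (N : ℝ) * ∑ i, ∑ j, φ (X i) (X j)))) ∂(Measure.pi fun _ : Fin N => ν) :=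
        integral_mono_of_nonneg (ae_of_all _ fun y => (Real.exp_pos _).le)
          (iP.add iM) (ae_of_all _ fun X => Real.exp_abs_le _)
    _ = _ := integral_add iP iM
    _ ≤ 1 / (1 - 8 * B) + 1 / (1 - 8 * B) := add_le_add rP rM
    _ = _ := by ring

/-- exponential law of large numbers, Jabin–Wang: there is a
universal constant `Ĉ > 0` such that for all `d, N ≥ 1`, every probability
density `μ ∈ L¹(𝕋^d)` and every `φ ∈ L^∞(𝕋^d × 𝕋^d)` with
`γ = Ĉ ‖φ‖_∞ < 1` and the cancellations `∫ φ(x,z) μ(x) dx = 0` for all `z` and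
`∫ φ(x,z) μ(z) dz = 0` for all `x`, one has
`∫_{𝕋^{dN}} μ^{⊗N} exp |(1/N) Σ_{i,j=1}^N φ(x_i,x_j)| ≤ 2/(1−γ)`. -/
theorem statement17 :
    ∃ Chat : ℝ, 0 < Chat ∧
      ∀ (d N : ℕ), 1 ≤ d → 1 ≤ N →
      ∀ μ : (Fin d → ℝ) → ℝ,
        Measurable μ → TorusFun μ → (∀ x, 0 ≤ μ x) →
        IntegrableOn μ (box d) → (∫ x in box d, μ x) = 1 →
      ∀ φ : (Fin d → ℝ) → (Fin d → ℝ) → ℝ,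
        Measurable (Function.uncurry φ) →
        (∀ (x z : Fin d → ℝ) (m : Lat d), φ (fun i => x i + (m i : ℝ)) z = φ x z) →
        (∀ (x z : Fin d → ℝ) (m : Lat d), φ x (fun i => z i + (m i : ℝ)) = φ x z) →
      ∀ B : ℝ, (∀ x z, |φ x z| ≤ B) → Chat * B < 1 →
        (∀ z, (∫ x in box d, φ x z * μ x) = 0) →
        (∀ x, (∫ z in box d, φ x z * μ z) = 0) →
        (∫ X in (Set.univ.pi fun _ : Fin N => box d),
            (∏ i, μ (X i)) *
              Real.exp |(1 / (N : ℝ)) * ∑ i : Fin N, ∑ j : Fin N, φ (X i) (X j)|)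
          ≤ 2 / (1 - Chat * B) := by
  refine ⟨8, by norm_num, ?_⟩
  intro d N _ hN μ hμ _ hμ0 hμi hμ1 φ hφ _ _ B hB hB8 h1 h2
  exact main_bound d N hN μ hμ hμ0 hμi hμ1 φ hφ B hB hB8 h1 h2

end PaperTorus
end
end
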